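/- arXiv:2111.15233 — 3 statements merged into one kernel-verified Lean document; each statement's English description precedes it below -/
import Mathlib

section
/- Suppose 𝒞 and 𝒵 are finite nonempty sets of real numbers, p satisfies Z ⊥ C | A and Y ⊥ A | (Z,C), and there exist real numbers γ₀, γ₁, γ₂ such that E(Y|z,c) = γ₀ + γ₁·z + γ₂·c for all (z,c). Then Var_p(φ_fd) − Var_p(φ_bd) = Σ_{z,c} var(Y|z,c)·p(c)·(Σ_ā p(ā|c)·(p(z|a⋆) − p(z|a°))²/p(z|ā) − p(z|a⋆)/p(a⋆|c) − p(z|a°)/p(a°|c)) + Σ_z (p(z|a⋆) − p(z|a°))²·Σ_ā γ₂²·var(C|ā)·p(ā)/p(z|ā) + γ₁²·var(Z|a⋆)·(1/p(a⋆) − Σ_c p(c)/p(a⋆|c)) + γ₁²·var(Z|a°)·(1/p(a°) − Σ_c p(c)/p(a°|c)), where var(C|ā) = Σ_c c²·p(c|ā) − (Σ_c c·p(c|ā))² with p(c|ā) = p(ā,c)/p(ā), and var(Z|ă) = Σ_z z²·p(z|ă) − (Σ_z z·p(z|ă))². -/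
open Finset

noncomputable section

namespace TwoDoorPaper

/-- Indicator 1[a = b] as a real number. -/
def ind {A : Type*} [DecidableEq A] (a b : A) : ℝ := if a = b then 1 else 0

variable {C A Z Y : Type*} [Fintype C] [Fintype A] [Fintype Z] [Fintype Y]

/-- Marginal p(c). -/
def pC (p : C → A → Z → Y → ℝ) (c : C) : ℝ := ∑ a, ∑ z, ∑ y, p c a z y

/-- Marginal p(a,c). -/
def pAC (p : C → A → Z → Y → ℝ) (a : A) (c : C) : ℝ := ∑ z, ∑ y, p c a z y

/-- Marginal p(c,a,z). -/
def pCAZ (p : C → A → Z → Y → ℝ) (c : C) (a : A) (z : Z) : ℝ := ∑ y, p c a z y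

/-- Marginal p(a). -/
def pA (p : C → A → Z → Y → ℝ) (a : A) : ℝ := ∑ c, pAC p a c

/-- Marginal p(a,z). -/
def pAZ (p : C → A → Z → Y → ℝ) (a : A) (z : Z) : ℝ := ∑ c, pCAZ p c a z

/-- Marginal p(z,c). -/
def pZC (p : C → A → Z → Y → ℝ) (z : Z) (c : C) : ℝ := ∑ a, pCAZ p c a z

/-- Conditional p(a|c). -/
def cA (p : C → A → Z → Y → ℝ) (a : A) (c : C) : ℝ := pAC p a c / pC p c

/-- Conditional p(z|a,c). -/
def cZ (p : C → A → Z → Y → ℝ) (z : Z) (a : A) (c : C) : ℝ := pCAZ p c a z / pAC p a c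

/-- Conditional p(z|a). -/
def cZA (p : C → A → Z → Y → ℝ) (z : Z) (a : A) : ℝ := pAZ p a z / pA p a

/-- Conditional p(y|a,z,c). -/
def cY (p : C → A → Z → Y → ℝ) (a : A) (z : Z) (c : C) (y : Y) : ℝ := p c a z y / pCAZ p c a z

/-- Conditional p(y|a,z). -/
def cYaz (p : C → A → Z → Y → ℝ) (a : A) (z : Z) (y : Y) : ℝ := (∑ c, p c a z y) / pAZ p a z

/-- Conditional p(y|a,c). -/
def cYac (p : C → A → Z → Y → ℝ) (a : A) (c : C) (y : Y) : ℝ := (∑ z, p c a z y) / pAC p a c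

/-- Conditional p(y|z,c). -/
def cYzc (p : C → A → Z → Y → ℝ) (z : Z) (c : C) (y : Y) : ℝ := (∑ a, p c a z y) / pZC p z c

/-- Conditional expectation E(Y|a,z,c). -/
def EYazc (p : C → A → Z → Y → ℝ) (yv : Y → ℝ) (a : A) (z : Z) (c : C) : ℝ :=
  ∑ y, yv y * cY p a z c y

/-- Conditional variance var(Y|a,z,c). -/
def VYazc (p : C → A → Z → Y → ℝ) (yv : Y → ℝ) (a : A) (z : Z) (c : C) : ℝ :=
  (∑ y, (yv y) ^ 2 * cY p a z c y) - (EYazc p yv a z c) ^ 2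

/-- Conditional expectation E(Y|a,z). -/
def EYaz (p : C → A → Z → Y → ℝ) (yv : Y → ℝ) (a : A) (z : Z) : ℝ :=
  ∑ y, yv y * cYaz p a z y

/-- Conditional variance var(Y|a,z). -/
def VYaz (p : C → A → Z → Y → ℝ) (yv : Y → ℝ) (a : A) (z : Z) : ℝ :=
  (∑ y, (yv y) ^ 2 * cYaz p a z y) - (EYaz p yv a z) ^ 2

/-- Conditional expectation E(Y|a,c). -/
def EYac (p : C → A → Z → Y → ℝ) (yv : Y → ℝ) (a : A) (c : C) : ℝ :=
  ∑ y, yv y * cYac p a c y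

/-- Conditional expectation E(Y|z,c). -/
def EYzc (p : C → A → Z → Y → ℝ) (yv : Y → ℝ) (z : Z) (c : C) : ℝ :=
  ∑ y, yv y * cYzc p z c y

/-- Conditional variance var(Y|z,c). -/
def VYzc (p : C → A → Z → Y → ℝ) (yv : Y → ℝ) (z : Z) (c : C) : ℝ :=
  (∑ y, (yv y) ^ 2 * cYzc p z c y) - (EYzc p yv z c) ^ 2

/-- var(C|a) for real-valued covariates. -/
def VCgivenA (p : C → A → Z → Y → ℝ) (cv : C → ℝ) (a : A) : ℝ :=
  (∑ c, (cv c) ^ 2 * (pAC p a c / pA p a)) - (∑ c, cv c * (pAC p a c / pA p a)) ^ 2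

/-- var(Z|a) for real-valued mediators. -/
def VZgivenA (p : C → A → Z → Y → ℝ) (zv : Z → ℝ) (a : A) : ℝ :=
  (∑ z, (zv z) ^ 2 * cZA p z a) - (∑ z, zv z * cZA p z a) ^ 2

/-- Expectation of f under p. -/
def Ep (p : C → A → Z → Y → ℝ) (f : C → A → Z → Y → ℝ) : ℝ :=
  ∑ c, ∑ a, ∑ z, ∑ y, p c a z y * f c a z y

/-- Variance of f under p. -/
def Varp (p : C → A → Z → Y → ℝ) (f : C → A → Z → Y → ℝ) : ℝ :=
  (∑ c, ∑ a, ∑ z, ∑ y, p c a z y * (f c a z y) ^ 2) - (Ep p f) ^ 2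

/-- p is a strictly positive probability mass function. -/
def IsPMF (p : C → A → Z → Y → ℝ) : Prop :=
  (∀ c a z y, 0 < p c a z y) ∧ (∑ c, ∑ a, ∑ z, ∑ y, p c a z y) = 1

/-- Y ⊥ A | (Z, C): p(y|a,z,c) does not depend on a. -/
def IndepYA (p : C → A → Z → Y → ℝ) : Prop :=
  ∀ a a' z c y, cY p a z c y = cY p a' z c y

/-- Z ⊥ C | A: p(z|a,c) = p(z|a) for all c. -/
def IndepZC (p : C → A → Z → Y → ℝ) : Prop :=
  ∀ z a c, cZ p z a c = cZA p z a

/-- θ_td. -/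
def thTD (p : C → A → Z → Y → ℝ) (yv : Y → ℝ) (astar acirc : A) : ℝ :=
  ∑ z, ∑ c, ∑ ab, EYazc p yv ab z c * (cZ p z astar c - cZ p z acirc c) * cA p ab c * pC p c

/-- The two-door efficient influence function φ_td. -/
def phiTD [DecidableEq A] (p : C → A → Z → Y → ℝ) (yv : Y → ℝ) (astar acirc : A)
    (c : C) (a : A) (z : Z) (y : Y) : ℝ :=
  (yv y - EYazc p yv a z c) * (cZ p z astar c - cZ p z acirc c) / cZ p z a c
  + ((∑ ab, EYazc p yv ab z c * cA p ab c)
      - ∑ ab, ∑ z', EYazc p yv ab z' c * cZ p z' a c * cA p ab c)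
    * (ind a astar - ind a acirc) / cA p a c
  + (∑ z', EYazc p yv a z' c * (cZ p z' astar c - cZ p z' acirc c))
  - thTD p yv astar acirc

/-- θ_bd. -/
def thBD (p : C → A → Z → Y → ℝ) (yv : Y → ℝ) (astar acirc : A) : ℝ :=
  ∑ c, pC p c * (EYac p yv astar c - EYac p yv acirc c)

/-- The back-door efficient influence function φ_bd. -/
def phiBD [DecidableEq A] (p : C → A → Z → Y → ℝ) (yv : Y → ℝ) (astar acirc : A)
    (c : C) (a : A) (_z : Z) (y : Y) : ℝ :=
  ind a astar * (yv y - EYac p yv astar c) / cA p astar c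
  - ind a acirc * (yv y - EYac p yv acirc c) / cA p acirc c
  + EYac p yv astar c - EYac p yv acirc c - thBD p yv astar acirc

/-- θ° (for the combined back-door/two-door model). -/
def thBDTD (p : C → A → Z → Y → ℝ) (yv : Y → ℝ) (astar acirc : A) : ℝ :=
  ∑ z, ∑ c, EYzc p yv z c * (cZ p z astar c - cZ p z acirc c) * pC p c

/-- The efficient influence function φ_bdtd. -/
def phiBDTD [DecidableEq A] (p : C → A → Z → Y → ℝ) (yv : Y → ℝ) (astar acirc : A)
    (c : C) (a : A) (z : Z) (y : Y) : ℝ :=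
  (yv y - EYzc p yv z c) * (cZ p z astar c - cZ p z acirc c) / (∑ ab, cZ p z ab c * cA p ab c)
  + (EYzc p yv z c - ∑ z', EYzc p yv z' c * cZ p z' a c)
    * (ind a astar - ind a acirc) / cA p a c
  + (∑ z', EYzc p yv z' c * (cZ p z' astar c - cZ p z' acirc c))
  - thBDTD p yv astar acirc

/-- ψ_fd(ă). -/
def psiFD (p : C → A → Z → Y → ℝ) (yv : Y → ℝ) (abreve : A) : ℝ :=
  ∑ z, ∑ ab, EYaz p yv ab z * pA p ab * cZA p z abreve

/-- θ_fd. -/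
def thFD (p : C → A → Z → Y → ℝ) (yv : Y → ℝ) (astar acirc : A) : ℝ :=
  psiFD p yv astar - psiFD p yv acirc

/-- The front-door efficient influence function φ_fd. -/
def phiFD [DecidableEq A] (p : C → A → Z → Y → ℝ) (yv : Y → ℝ) (astar acirc : A)
    (_c : C) (a : A) (z : Z) (y : Y) : ℝ :=
  (yv y - EYaz p yv a z) * (cZA p z astar - cZA p z acirc) / cZA p z a
  + ind a astar * ((∑ ab, EYaz p yv ab z * pA p ab) - psiFD p yv astar) / pA p astar
  - ind a acirc * ((∑ ab, EYaz p yv ab z * pA p ab) - psiFD p yv acirc) / pA p acirc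
  + (∑ z', EYaz p yv a z' * (cZA p z' astar - cZA p z' acirc))
  - thFD p yv astar acirc

/-- θ' (for the combined front-door/two-door model). -/
def thFDTD (p : C → A → Z → Y → ℝ) (yv : Y → ℝ) (astar acirc : A) : ℝ :=
  ∑ c, ∑ ab, ∑ z, EYazc p yv ab z c * (cZA p z astar - cZA p z acirc) * cA p ab c * pC p c

/-- The efficient influence function φ_fdtd. -/
def phiFDTD [DecidableEq A] (p : C → A → Z → Y → ℝ) (yv : Y → ℝ) (astar acirc : A)
    (c : C) (a : A) (z : Z) (y : Y) : ℝ :=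
  (yv y - EYazc p yv a z c) * (cZA p z astar - cZA p z acirc) / cZA p z a
  + (∑ c', ((∑ ab, EYazc p yv ab z c' * cA p ab c')
        - ∑ ab, ∑ z', EYazc p yv ab z' c' * cZA p z' a * cA p ab c') * pC p c')
    * (ind a astar - ind a acirc) / pA p a
  + (∑ z', EYazc p yv a z' c * (cZA p z' astar - cZA p z' acirc))
  - thFDTD p yv astar acirc

/-- θ'' (for the combined back/front/two-door model). -/
def thBDFDTD (p : C → A → Z → Y → ℝ) (yv : Y → ℝ) (astar acirc : A) : ℝ :=
  ∑ c, ∑ z, EYzc p yv z c * (cZA p z astar - cZA p z acirc) * pC p c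

/-- The efficient influence function φ_bdfdtd. -/
def phiBDFDTD [DecidableEq A] (p : C → A → Z → Y → ℝ) (yv : Y → ℝ) (astar acirc : A)
    (c : C) (a : A) (z : Z) (y : Y) : ℝ :=
  (yv y - EYzc p yv z c) * (cZA p z astar - cZA p z acirc) / (∑ ab, cA p ab c * cZA p z ab)
  + (∑ c', (EYzc p yv z c' - ∑ z', EYzc p yv z' c' * cZA p z' a) * pC p c')
    * (ind a astar - ind a acirc) / (∑ c', pC p c' * cA p a c')
  + (∑ z', EYzc p yv z' c * (cZA p z' astar - cZA p z' acirc))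
  - thBDFDTD p yv astar acirc


/-- Second moment of an affine function of `x` under weights `w` of total mass `W`, mean `m`
and variance `V`. -/
lemma sum_mul_affine_sq {ι : Type*} [Fintype ι] (w x : ι → ℝ) {W m V : ℝ}
    (hW : ∑ i, w i = W) (hm : ∑ i, x i * w i = W * m)
    (hV : ∑ i, x i ^ 2 * w i = W * (V + m ^ 2)) (α β : ℝ) :
    ∑ i, w i * (α * (x i - m) + β) ^ 2 = W * (α ^ 2 * V + β ^ 2) := by
  have h : ∀ i, w i * (α * (x i - m) + β) ^ 2
      = α ^ 2 * (x i ^ 2 * w i) + 2 * α * (β - α * m) * (x i * w i)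
        + (β - α * m) ^ 2 * w i := fun i => by ring
  simp only [h, sum_add_distrib, ← mul_sum, hW, hm, hV]
  ring

/-- Mean of an affine function of `x` under weights `w` of total mass `W` and mean `m`. -/
lemma sum_mul_affine {ι : Type*} [Fintype ι] (w x : ι → ℝ) {W m : ℝ}
    (hW : ∑ i, w i = W) (hm : ∑ i, x i * w i = W * m) (α β : ℝ) :
    ∑ i, w i * (α * (x i - m) + β) = W * β := by
  have h : ∀ i, w i * (α * (x i - m) + β)
      = α * (x i * w i) + (β - α * m) * w i := fun i => by ring
  simp only [h, sum_add_distrib, ← mul_sum, hW, hm]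
  ring

/-- A sum against a squared signed combination of two distinct indicators. -/
lemma sum_mul_ind_sub_ind_sq [DecidableEq A] {a b : A} (hab : a ≠ b) (F k l : A → ℝ) :
    ∑ i, F i * (ind i a * k i - ind i b * l i) ^ 2 = F a * k a ^ 2 + F b * l b ^ 2 := by
  have h : ∀ i, F i * (ind i a * k i - ind i b * l i) ^ 2
      = (if i = a then F i * k i ^ 2 else 0) + (if i = b then F i * l i ^ 2 else 0) := by
    intro i
    by_cases ha : i = a <;> by_cases hb : i = b <;> simp [ind, ha, hb]
    · exact absurd (ha.symm.trans hb) hab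
    · simp [hab]
    · simp [hab.symm]
  simp [h, sum_add_distrib]

section Marginals

variable {p : C → A → Z → Y → ℝ}

lemma pCAZ_pos [Nonempty Y] (hp : IsPMF p) (c : C) (a : A) (z : Z) : 0 < pCAZ p c a z :=
  sum_pos (fun _ _ => hp.1 _ _ _ _) univ_nonempty

lemma pAC_pos [Nonempty Z] [Nonempty Y] (hp : IsPMF p) (a : A) (c : C) : 0 < pAC p a c :=
  sum_pos (fun z _ => pCAZ_pos hp c a z) univ_nonempty

lemma pA_pos [Nonempty C] [Nonempty Z] [Nonempty Y] (hp : IsPMF p) (a : A) : 0 < pA p a :=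
  sum_pos (fun c _ => pAC_pos hp a c) univ_nonempty

lemma pC_pos [Nonempty A] [Nonempty Z] [Nonempty Y] (hp : IsPMF p) (c : C) : 0 < pC p c :=
  sum_pos (fun a _ => pAC_pos hp a c) univ_nonempty

lemma pAZ_pos [Nonempty C] [Nonempty Y] (hp : IsPMF p) (a : A) (z : Z) : 0 < pAZ p a z :=
  sum_pos (fun c _ => pCAZ_pos hp c a z) univ_nonempty

lemma pZC_pos [Nonempty A] [Nonempty Y] (hp : IsPMF p) (z : Z) (c : C) : 0 < pZC p z c :=
  sum_pos (fun a _ => pCAZ_pos hp c a z) univ_nonempty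

lemma cZA_pos [Nonempty C] [Nonempty Z] [Nonempty Y] (hp : IsPMF p) (z : Z) (a : A) :
    0 < cZA p z a :=
  div_pos (pAZ_pos hp a z) (pA_pos hp a)

lemma cA_pos [Nonempty A] [Nonempty Z] [Nonempty Y] (hp : IsPMF p) (a : A) (c : C) :
    0 < cA p a c :=
  div_pos (pAC_pos hp a c) (pC_pos hp c)

lemma sum_pC (hp : IsPMF p) : ∑ c, pC p c = 1 := hp.2

lemma sum_pA (hp : IsPMF p) : ∑ a, pA p a = 1 := by
  rw [← hp.2]
  exact sum_comm

lemma pAZ_eq [Nonempty C] [Nonempty Z] [Nonempty Y] (hp : IsPMF p) (a : A) (z : Z) :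
    pAZ p a z = pA p a * cZA p z a :=
  (mul_div_cancel₀ _ (pA_pos hp a).ne').symm

lemma sum_cZA [Nonempty C] [Nonempty Z] [Nonempty Y] (hp : IsPMF p) (a : A) :
    ∑ z, cZA p z a = 1 := by
  have h : ∑ z, pAZ p a z = pA p a := sum_comm
  simp only [cZA, ← sum_div, h]
  exact div_self (pA_pos hp a).ne'

lemma pAC_eq [Nonempty A] [Nonempty Z] [Nonempty Y] (hp : IsPMF p) (a : A) (c : C) :
    pAC p a c = cA p a c * pC p c :=
  (div_mul_cancel₀ _ (pC_pos hp c).ne').symm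

/-- Factorisation of `p(c,a,z)` under `Z ⊥ C | A`. -/
lemma pCAZ_eq [Nonempty Z] [Nonempty Y] (hp : IsPMF p) (hzc : IndepZC p)
    (c : C) (a : A) (z : Z) : pCAZ p c a z = pAC p a c * cZA p z a := by
  rw [← hzc z a c, cZ, mul_div_cancel₀ _ (pAC_pos hp a c).ne']

/-- Factorisation of `p` under `Y ⊥ A | (Z,C)`. -/
lemma eq_pCAZ_mul_cYzc [Nonempty A] [Nonempty Y] (hp : IsPMF p) (hind : IndepYA p)
    (c : C) (a : A) (z : Z) (y : Y) : p c a z y = pCAZ p c a z * cYzc p z c y := by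
  have h : ∀ a', p c a' z y = pCAZ p c a' z * cY p a z c y := fun a' => by
    rw [hind a a' z c y, cY, mul_div_cancel₀ _ (pCAZ_pos hp c a' z).ne']
  have hzc : cYzc p z c y = cY p a z c y := by
    rw [cYzc, div_eq_iff (pZC_pos hp z c).ne', pZC, mul_sum]
    exact sum_congr rfl fun a' _ => by rw [h a', mul_comm]
  rw [hzc, ← h]

lemma sum_yv_mul [Nonempty A] [Nonempty Y] (hp : IsPMF p) (hind : IndepYA p) (yv : Y → ℝ)
    (c : C) (a : A) (z : Z) : ∑ y, yv y * p c a z y = pCAZ p c a z * EYzc p yv z c := by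
  rw [EYzc, mul_sum]
  exact sum_congr rfl fun y _ => by rw [eq_pCAZ_mul_cYzc hp hind]; ring

lemma sum_yv_sq_mul [Nonempty A] [Nonempty Y] (hp : IsPMF p) (hind : IndepYA p) (yv : Y → ℝ)
    (c : C) (a : A) (z : Z) :
    ∑ y, yv y ^ 2 * p c a z y = pCAZ p c a z * (VYzc p yv z c + EYzc p yv z c ^ 2) := by
  rw [VYzc, sub_add_cancel, mul_sum]
  exact sum_congr rfl fun y _ => by rw [eq_pCAZ_mul_cYzc hp hind]; ring

/-- Conditional mean of the mediator given the treatment. -/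
def meanZ (p : C → A → Z → Y → ℝ) (zv : Z → ℝ) (a : A) : ℝ := ∑ z, zv z * cZA p z a

/-- Conditional mean of the covariate given the treatment. -/
def meanC (p : C → A → Z → Y → ℝ) (cv : C → ℝ) (a : A) : ℝ := ∑ c, cv c * (pAC p a c / pA p a)

lemma sum_cv_mul [Nonempty C] [Nonempty Z] [Nonempty Y] (hp : IsPMF p) (cv : C → ℝ) (a : A) :
    ∑ c, cv c * pAC p a c = pA p a * meanC p cv a := by
  have := (pA_pos hp a).ne'
  rw [meanC, mul_sum]
  exact sum_congr rfl fun c _ => by field_simp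

lemma sum_cv_sq_mul [Nonempty C] [Nonempty Z] [Nonempty Y] (hp : IsPMF p) (cv : C → ℝ)
    (a : A) :
    ∑ c, cv c ^ 2 * pAC p a c = pA p a * (VCgivenA p cv a + meanC p cv a ^ 2) := by
  have := (pA_pos hp a).ne'
  rw [VCgivenA, meanC, sub_add_cancel, mul_sum]
  exact sum_congr rfl fun c _ => by field_simp

/-- Second moment of an affine function of `z` with mean-centred argument. -/
lemma sum_cZA_mul_affine_sq [Nonempty C] [Nonempty Z] [Nonempty Y] (hp : IsPMF p)
    (zv : Z → ℝ) (a : A) (s : ℝ) :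
    ∑ z, cZA p z a * (s * (zv z - meanZ p zv a)) ^ 2 = s ^ 2 * VZgivenA p zv a := by
  have h := sum_mul_affine_sq (fun z => cZA p z a) zv (sum_cZA hp a)
    (m := meanZ p zv a) (one_mul _).symm
    ((sub_add_cancel _ _).symm.trans (one_mul _).symm : _ = 1 * (VZgivenA p zv a + _)) s 0
  simpa using h

/-- Variance of a mean-zero function that is affine in the outcome. -/
lemma Varp_affine [Nonempty A] [Nonempty Y] (hp : IsPMF p) (hind : IndepYA p) (yv : Y → ℝ)
    {f : C → A → Z → Y → ℝ} {α β : C → A → Z → ℝ}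
    (hf : ∀ c a z y, f c a z y = α c a z * (yv y - EYzc p yv z c) + β c a z)
    (hβ : ∑ c, ∑ a, ∑ z, pCAZ p c a z * β c a z = 0) :
    Varp p f
      = ∑ c, ∑ a, ∑ z, pCAZ p c a z * (α c a z ^ 2 * VYzc p yv z c + β c a z ^ 2) := by
  have hE : Ep p f = 0 := by
    rw [← hβ, Ep]
    refine sum_congr rfl fun c _ => sum_congr rfl fun a _ => sum_congr rfl fun z _ => ?_
    simp only [hf]
    exact sum_mul_affine _ yv rfl (sum_yv_mul hp hind yv c a z) _ _
  rw [Varp, hE, zero_pow two_ne_zero, sub_zero]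
  refine sum_congr rfl fun c _ => sum_congr rfl fun a _ => sum_congr rfl fun z _ => ?_
  simp only [hf]
  exact sum_mul_affine_sq _ yv rfl (sum_yv_mul hp hind yv c a z)
    (sum_yv_sq_mul hp hind yv c a z) _ _

/-- The mediator centred at its conditional mean has conditional mean zero. -/
lemma sum_cZA_mul_sub_meanZ [Nonempty C] [Nonempty Z] [Nonempty Y] (hp : IsPMF p)
    (zv : Z → ℝ) (a : A) : ∑ z, cZA p z a * (zv z - meanZ p zv a) = 0 := by
  have h := sum_mul_affine (fun z => cZA p z a) zv (sum_cZA hp a)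
    (m := meanZ p zv a) (one_mul _).symm 1 0
  simpa using h

lemma sum_linear_mul_cZA [Nonempty C] [Nonempty Z] [Nonempty Y] (hp : IsPMF p) {zv : Z → ℝ}
    {γ₁ : ℝ} (k : ℝ) (a : A) :
    ∑ z, (k + γ₁ * zv z) * cZA p z a = k + γ₁ * meanZ p zv a := by
  have h : ∀ z, (k + γ₁ * zv z) * cZA p z a = k * cZA p z a + γ₁ * (zv z * cZA p z a) :=
    fun z => by ring
  simp only [h, sum_add_distrib, ← mul_sum, sum_cZA hp, meanZ, mul_one]

end Marginals

section Linear

variable [Nonempty C] [Nonempty A] [Nonempty Z] [Nonempty Y] {p : C → A → Z → Y → ℝ}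
  {cv : C → ℝ} {zv : Z → ℝ} {yv : Y → ℝ} {γ₀ γ₁ γ₂ : ℝ}

lemma EYac_eq (hp : IsPMF p) (hzc : IndepZC p) (hind : IndepYA p)
    (hlin : ∀ z c, EYzc p yv z c = γ₀ + γ₁ * zv z + γ₂ * cv c) (a : A) (c : C) :
    EYac p yv a c = γ₀ + γ₁ * meanZ p zv a + γ₂ * cv c := by
  have hac := (pAC_pos hp a c).ne'
  have h1 : EYac p yv a c * pAC p a c = ∑ z, ∑ y, yv y * p c a z y := by
    rw [sum_comm, EYac, sum_mul]
    refine sum_congr rfl fun y _ => ?_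
    rw [cYac, ← mul_sum]
    field_simp
  have h2 : ∀ z, pCAZ p c a z * EYzc p yv z c
      = pAC p a c * (((γ₀ + γ₂ * cv c) + γ₁ * zv z) * cZA p z a) := fun z => by
    rw [pCAZ_eq hp hzc, hlin]; ring
  simp only [sum_yv_mul hp hind, h2, ← mul_sum, sum_linear_mul_cZA hp] at h1
  rw [mul_comm] at h1
  rw [mul_left_cancel₀ hac h1]
  ring

lemma EYaz_eq (hp : IsPMF p) (hzc : IndepZC p) (hind : IndepYA p)
    (hlin : ∀ z c, EYzc p yv z c = γ₀ + γ₁ * zv z + γ₂ * cv c) (a : A) (z : Z) :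
    EYaz p yv a z = γ₀ + γ₁ * zv z + γ₂ * meanC p cv a := by
  have haz := (pAZ_pos hp a z).ne'
  have h1 : EYaz p yv a z * pAZ p a z = ∑ c, ∑ y, yv y * p c a z y := by
    rw [sum_comm, EYaz, sum_mul]
    refine sum_congr rfl fun y _ => ?_
    rw [cYaz, ← mul_sum]
    field_simp
  have h2 : ∀ c, pCAZ p c a z * EYzc p yv z c
      = cZA p z a * ((γ₀ + γ₁ * zv z) * pAC p a c + γ₂ * (cv c * pAC p a c)) := fun c => by
    rw [pCAZ_eq hp hzc, hlin]; ring
  have h3 : ∑ c, pAC p a c = pA p a := rfl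
  simp only [sum_yv_mul hp hind, h2, ← mul_sum, sum_add_distrib, h3, sum_cv_mul hp cv] at h1
  refine mul_right_cancel₀ haz (h1.trans ?_)
  rw [pAZ_eq hp]
  ring

lemma sum_EYaz_mul_pA (hp : IsPMF p) (hzc : IndepZC p) (hind : IndepYA p)
    (hlin : ∀ z c, EYzc p yv z c = γ₀ + γ₁ * zv z + γ₂ * cv c) (z : Z) :
    ∑ a, EYaz p yv a z * pA p a = (γ₀ + γ₂ * ∑ a, meanC p cv a * pA p a) + γ₁ * zv z := by
  have h : ∀ a, EYaz p yv a z * pA p a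
      = (γ₀ + γ₁ * zv z) * pA p a + γ₂ * (meanC p cv a * pA p a) := fun a => by
    rw [EYaz_eq hp hzc hind hlin]; ring
  simp only [h, sum_add_distrib, ← mul_sum, sum_pA hp]
  ring

lemma psiFD_eq (hp : IsPMF p) (hzc : IndepZC p) (hind : IndepYA p)
    (hlin : ∀ z c, EYzc p yv z c = γ₀ + γ₁ * zv z + γ₂ * cv c) (a : A) :
    psiFD p yv a = (γ₀ + γ₂ * ∑ a, meanC p cv a * pA p a) + γ₁ * meanZ p zv a := by
  simp only [psiFD, ← sum_mul, sum_EYaz_mul_pA hp hzc hind hlin, sum_linear_mul_cZA hp]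

lemma thBD_eq (hp : IsPMF p) (hzc : IndepZC p) (hind : IndepYA p)
    (hlin : ∀ z c, EYzc p yv z c = γ₀ + γ₁ * zv z + γ₂ * cv c) (a b : A) :
    thBD p yv a b = γ₁ * (meanZ p zv a - meanZ p zv b) := by
  have h : ∀ c, pC p c * (EYac p yv a c - EYac p yv b c)
      = pC p c * (γ₁ * (meanZ p zv a - meanZ p zv b)) := fun c => by
    rw [EYac_eq hp hzc hind hlin, EYac_eq hp hzc hind hlin]; ring
  simp only [thBD, h, ← sum_mul, sum_pC hp, one_mul]

lemma phiFD_eq [DecidableEq A] (hp : IsPMF p) (hzc : IndepZC p) (hind : IndepYA p)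
    (hlin : ∀ z c, EYzc p yv z c = γ₀ + γ₁ * zv z + γ₂ * cv c) (a₁ a₀ : A)
    (c : C) (a : A) (z : Z) (y : Y) :
    phiFD p yv a₁ a₀ c a z y
      = (cZA p z a₁ - cZA p z a₀) / cZA p z a * (yv y - EYzc p yv z c)
        + (γ₂ * ((cZA p z a₁ - cZA p z a₀) / cZA p z a) * (cv c - meanC p cv a)
          + γ₁ * (ind a a₁ * (1 / pA p a) - ind a a₀ * (1 / pA p a))
            * (zv z - meanZ p zv a)) := by
  have h : ∑ z', EYaz p yv a z' * (cZA p z' a₁ - cZA p z' a₀)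
      = γ₁ * (meanZ p zv a₁ - meanZ p zv a₀) := by
    have h' : ∀ z', EYaz p yv a z' * (cZA p z' a₁ - cZA p z' a₀)
        = ((γ₀ + γ₂ * meanC p cv a) + γ₁ * zv z') * cZA p z' a₁
          - ((γ₀ + γ₂ * meanC p cv a) + γ₁ * zv z') * cZA p z' a₀ := fun z' => by
      rw [EYaz_eq hp hzc hind hlin]; ring
    simp only [h', sum_sub_distrib, sum_linear_mul_cZA hp]
    ring
  rw [phiFD, h, thFD, psiFD_eq hp hzc hind hlin, psiFD_eq hp hzc hind hlin,
    sum_EYaz_mul_pA hp hzc hind hlin, EYaz_eq hp hzc hind hlin, hlin]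
  rcases eq_or_ne a a₁ with rfl | h1 <;> rcases eq_or_ne a a₀ with rfl | h0 <;>
    simp [ind, *] <;> ring

lemma phiBD_eq [DecidableEq A] (hp : IsPMF p) (hzc : IndepZC p) (hind : IndepYA p)
    (hlin : ∀ z c, EYzc p yv z c = γ₀ + γ₁ * zv z + γ₂ * cv c) (a₁ a₀ : A)
    (c : C) (a : A) (z : Z) (y : Y) :
    phiBD p yv a₁ a₀ c a z y
      = (ind a a₁ * (1 / cA p a c) - ind a a₀ * (1 / cA p a c)) * (yv y - EYzc p yv z c)
        + γ₁ * (ind a a₁ * (1 / cA p a c) - ind a a₀ * (1 / cA p a c))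
          * (zv z - meanZ p zv a) := by
  rw [phiBD, thBD_eq hp hzc hind hlin, EYac_eq hp hzc hind hlin, EYac_eq hp hzc hind hlin, hlin]
  rcases eq_or_ne a a₁ with rfl | h1 <;> rcases eq_or_ne a a₀ with rfl | h0 <;>
    simp [ind, *] <;> ring

/-- Variance of the front-door influence function in the linear model. -/
lemma Varp_phiFD [DecidableEq A] (hp : IsPMF p) (hzc : IndepZC p) (hind : IndepYA p)
    (hlin : ∀ z c, EYzc p yv z c = γ₀ + γ₁ * zv z + γ₂ * cv c) {a₁ a₀ : A} (hne : a₁ ≠ a₀) :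
    Varp p (phiFD p yv a₁ a₀)
      = (∑ z, ∑ c, VYzc p yv z c * pC p c
          * ∑ a, cA p a c * (cZA p z a₁ - cZA p z a₀) ^ 2 / cZA p z a)
        + (∑ z, (cZA p z a₁ - cZA p z a₀) ^ 2
          * ∑ a, γ₂ ^ 2 * VCgivenA p cv a * pA p a / cZA p z a)
        + (γ₁ ^ 2 * VZgivenA p zv a₁ / pA p a₁ + γ₁ ^ 2 * VZgivenA p zv a₀ / pA p a₀) := by
  have hr := fun z a => (cZA_pos hp z a).ne'
  have hq := fun a => (pA_pos hp a).ne'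
  have hmass : ∀ a, ∑ c, pAC p a c = pA p a := fun a => rfl
  have hcycle : ∀ F : C → A → Z → ℝ, ∑ c, ∑ a, ∑ z, F c a z = ∑ a, ∑ z, ∑ c, F c a z :=
    fun F => sum_comm.trans (sum_congr rfl fun a _ => sum_comm)
  rw [Varp_affine hp hind yv (phiFD_eq hp hzc hind hlin a₁ a₀)]
  · simp only [mul_add, sum_add_distrib]
    rw [add_assoc]
    congr 1
    · rw [hcycle, sum_comm]
      refine sum_congr rfl fun z _ => ?_
      rw [sum_comm]
      refine sum_congr rfl fun c _ => ?_
      rw [mul_sum]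
      refine sum_congr rfl fun a _ => ?_
      rw [pCAZ_eq hp hzc, pAC_eq hp]
      have := hr z a
      field_simp
    · have hin : ∀ a z, ∑ c, pCAZ p c a z
          * (γ₂ * ((cZA p z a₁ - cZA p z a₀) / cZA p z a) * (cv c - meanC p cv a)
          + γ₁ * (ind a a₁ * (1 / pA p a) - ind a a₀ * (1 / pA p a))
            * (zv z - meanZ p zv a)) ^ 2
          = (cZA p z a₁ - cZA p z a₀) ^ 2 * (γ₂ ^ 2 * VCgivenA p cv a * pA p a / cZA p z a)
            + pA p a * (cZA p z a
              * (γ₁ * (ind a a₁ * (1 / pA p a) - ind a a₀ * (1 / pA p a))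
                * (zv z - meanZ p zv a)) ^ 2) := by
        intro a z
        simp only [pCAZ_eq hp hzc, mul_comm (pAC p a _) (cZA p z a), mul_assoc (cZA p z a),
          ← mul_sum]
        rw [sum_mul_affine_sq _ cv (hmass a) (sum_cv_mul hp cv a) (sum_cv_sq_mul hp cv a)]
        have := hr z a
        have := hq a
        field_simp
      rw [hcycle]
      simp only [hin, sum_add_distrib]
      congr 1
      · rw [sum_comm]
        simp only [mul_sum]
      · simp only [← mul_sum, sum_cZA_mul_affine_sq hp]
        have h : ∀ a, pA p a * ((γ₁ * (ind a a₁ * (1 / pA p a) - ind a a₀ * (1 / pA p a))) ^ 2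
              * VZgivenA p zv a)
            = (γ₁ ^ 2 * VZgivenA p zv a * pA p a)
              * (ind a a₁ * (1 / pA p a) - ind a a₀ * (1 / pA p a)) ^ 2 := fun a => by ring
        simp only [h]
        rw [sum_mul_ind_sub_ind_sq hne]
        have := hq a₁
        have := hq a₀
        field_simp
  · rw [hcycle]
    refine sum_eq_zero fun a _ => ?_
    simp only [pCAZ_eq hp hzc, mul_comm (pAC p a _) (cZA p _ a), mul_assoc (cZA p _ a),
      ← mul_sum, sum_mul_affine _ cv (hmass a) (sum_cv_mul hp cv a)]
    simp only [mul_left_comm (cZA p _ a), ← mul_sum, sum_cZA_mul_sub_meanZ hp, mul_zero]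

/-- Variance of the back-door influence function in the linear model. -/
lemma Varp_phiBD [DecidableEq A] (hp : IsPMF p) (hzc : IndepZC p) (hind : IndepYA p)
    (hlin : ∀ z c, EYzc p yv z c = γ₀ + γ₁ * zv z + γ₂ * cv c) {a₁ a₀ : A} (hne : a₁ ≠ a₀) :
    Varp p (phiBD p yv a₁ a₀)
      = (∑ z, ∑ c, VYzc p yv z c * pC p c
          * (cZA p z a₁ / cA p a₁ c + cZA p z a₀ / cA p a₀ c))
        + (γ₁ ^ 2 * VZgivenA p zv a₁ * ∑ c, pC p c / cA p a₁ c)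
        + (γ₁ ^ 2 * VZgivenA p zv a₀ * ∑ c, pC p c / cA p a₀ c) := by
  rw [Varp_affine hp hind yv (phiBD_eq hp hzc hind hlin a₁ a₀)]
  · rw [sum_comm (s := (univ : Finset Z)), mul_sum, mul_sum, ← sum_add_distrib,
      ← sum_add_distrib]
    refine sum_congr rfl fun c _ => ?_
    have hin : ∀ a, ∑ z, pCAZ p c a z
        * ((ind a a₁ * (1 / cA p a c) - ind a a₀ * (1 / cA p a c)) ^ 2 * VYzc p yv z c
          + (γ₁ * (ind a a₁ * (1 / cA p a c) - ind a a₀ * (1 / cA p a c))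
            * (zv z - meanZ p zv a)) ^ 2)
        = (pAC p a c * ((∑ z, cZA p z a * VYzc p yv z c) + γ₁ ^ 2 * VZgivenA p zv a))
          * (ind a a₁ * (1 / cA p a c) - ind a a₀ * (1 / cA p a c)) ^ 2 := by
      intro a
      simp only [pCAZ_eq hp hzc, mul_assoc (pAC p a c), ← mul_sum, mul_add, sum_add_distrib,
        sum_cZA_mul_affine_sq hp, mul_left_comm (cZA p _ a)]
      ring
    have hw : ∀ a, pAC p a c * (1 / cA p a c) ^ 2 = pC p c / cA p a c := fun a => by
      have := (cA_pos hp a c).ne'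
      rw [pAC_eq hp]
      field_simp
    have hs : ∑ z, VYzc p yv z c * pC p c * (cZA p z a₁ / cA p a₁ c + cZA p z a₀ / cA p a₀ c)
        = (∑ z, cZA p z a₁ * VYzc p yv z c) * (pC p c / cA p a₁ c)
          + (∑ z, cZA p z a₀ * VYzc p yv z c) * (pC p c / cA p a₀ c) := by
      rw [sum_mul, sum_mul, ← sum_add_distrib]
      exact sum_congr rfl fun z _ => by ring
    simp only [hin]
    rw [sum_mul_ind_sub_ind_sq hne, mul_right_comm, hw, mul_right_comm, hw, hs]
    ring
  · refine sum_eq_zero fun c _ => sum_eq_zero fun a _ => ?_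
    simp only [pCAZ_eq hp hzc, mul_assoc (pAC p a c), mul_left_comm (cZA p _ a), ← mul_sum,
      sum_cZA_mul_sub_meanZ hp, mul_zero]

end Linear

/-- Difference of the front-door and back-door bounds in a linear model with
Z ⊥ C | A and Y ⊥ A | (Z,C). -/
theorem stmt12
    {C A Z Y : Type*} [Fintype C] [Fintype A] [Fintype Z] [Fintype Y]
    [Nonempty C] [Nonempty A] [Nonempty Z] [Nonempty Y] [DecidableEq A]
    (cv : C → ℝ) (hcv : Function.Injective cv)
    (zv : Z → ℝ) (hzv : Function.Injective zv)
    (p : C → A → Z → Y → ℝ) (yv : Y → ℝ) (hyv : Function.Injective yv)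
    (hp : IsPMF p) (astar acirc : A) (hne : astar ≠ acirc)
    (hzc : IndepZC p) (hind : IndepYA p)
    (γ₀ γ₁ γ₂ : ℝ)
    (hlin : ∀ z c, EYzc p yv z c = γ₀ + γ₁ * zv z + γ₂ * cv c) :
    Varp p (phiFD p yv astar acirc) - Varp p (phiBD p yv astar acirc) =
      (∑ z, ∑ c, VYzc p yv z c * pC p c *
          ((∑ ab, cA p ab c * (cZA p z astar - cZA p z acirc) ^ 2 / cZA p z ab)
            - cZA p z astar / cA p astar c - cZA p z acirc / cA p acirc c))
      + (∑ z, (cZA p z astar - cZA p z acirc) ^ 2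
          * ∑ ab, γ₂ ^ 2 * VCgivenA p cv ab * pA p ab / cZA p z ab)
      + γ₁ ^ 2 * VZgivenA p zv astar * (1 / pA p astar - ∑ c, pC p c / cA p astar c)
      + γ₁ ^ 2 * VZgivenA p zv acirc * (1 / pA p acirc - ∑ c, pC p c / cA p acirc c) := by
  rw [Varp_phiFD hp hzc hind hlin hne, Varp_phiBD hp hzc hind hlin hne]
  have h : ∀ z c, VYzc p yv z c * pC p c *
        ((∑ ab, cA p ab c * (cZA p z astar - cZA p z acirc) ^ 2 / cZA p z ab)
          - cZA p z astar / cA p astar c - cZA p z acirc / cA p acirc c)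
      = VYzc p yv z c * pC p c
          * (∑ ab, cA p ab c * (cZA p z astar - cZA p z acirc) ^ 2 / cZA p z ab)
        - VYzc p yv z c * pC p c
          * (cZA p z astar / cA p astar c + cZA p z acirc / cA p acirc c) :=
    fun z c => by ring
  simp only [h, sum_sub_distrib]
  ring

end TwoDoorPaper
end
end

section
/- Suppose p satisfies Z ⊥ C | A and Y ⊥ A | (Z,C). Let Ē : 𝒵 × 𝒞 → ℝ be any function, let q_Z : 𝒵 × 𝒜 → ℝ satisfy q_Z(z|a) > 0 and Σ_z q_Z(z|a) = 1 for all a, let q_A : 𝒜 × 𝒞 → ℝ satisfy q_A(a|c) > 0 and Σ_a q_A(a|c) = 1 for all c, and let q_C : 𝒞 → ℝ satisfy q_C(c) > 0 and Σ_c q_C(c) = 1. Set θ₀ = Σ_{c,z} E(Y|z,c)·(p(z|a⋆) − p(z|a°))·p(c) and define φ̄(c,a,z,y) = (y − Ē(z,c))·(q_Z(z|a⋆) − q_Z(z|a°))/(Σ_ā q_A(ā|c)·q_Z(z|ā)) + (Σ_{c'} (Ē(z,c') − Σ_{z'} Ē(z',c')·q_Z(z'|a))·q_C(c'))·(1[a=a⋆]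 − 1[a=a°])/(Σ_{c'} q_A(a|c')·q_C(c')) + Σ_{z'} Ē(z',c)·(q_Z(z'|a⋆) − q_Z(z'|a°)) − θ₀. If at least one of the following holds: (i) Ē(z,c) = E(Y|z,c) for all (z,c), q_A(a|c) = p(a|c) for all (a,c), and q_C(c) = p(c) for all c; (ii) Ē(z,c) = E(Y|z,c) for all (z,c) and q_Z(z|a) = p(z|a) for all (z,a); (iii) q_Z(z|a) = p(z|a) for all (z,a) and q_A(a|c) = p(a|c) for all (a,c) — then E_p(φ̄) = 0. -/
open Finset

noncomputable section

namespace TwoDoorPaper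

variable {C A Z Y : Type*} [Fintype C] [Fintype A] [Fintype Z] [Fintype Y]

section Factorization

variable {p : C → A → Z → Y → ℝ}

lemma pC_mul_cA [Nonempty A] [Nonempty Z] [Nonempty Y] (hp : IsPMF p) (a : A) (c : C) :
    pC p c * cA p a c = pAC p a c :=
  mul_div_cancel₀ _ (pC_pos hp c).ne'

lemma sum_pC_mul_cA [Nonempty A] [Nonempty Z] [Nonempty Y] (hp : IsPMF p) (a : A) :
    ∑ c, pC p c * cA p a c = pA p a :=
  sum_congr rfl fun c _ => pC_mul_cA hp a c

lemma sum_cA [Nonempty A] [Nonempty Z] [Nonempty Y] (hp : IsPMF p) (c : C) :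
    ∑ a, cA p a c = 1 := by
  simp only [cA, ← sum_div]
  exact div_self (pC_pos hp c).ne'

/-- Under Z ⊥ C | A, the law of (C, A, Z) factorizes as p(c) p(a|c) p(z|a). -/
lemma pCAZ_eq_of_indepZC [Nonempty A] [Nonempty Z] [Nonempty Y] (hp : IsPMF p)
    (hzc : IndepZC p) (c : C) (a : A) (z : Z) :
    pCAZ p c a z = pC p c * cA p a c * cZA p z a := by
  rw [pC_mul_cA hp, ← hzc z a c, cZ, mul_div_cancel₀ _ (pAC_pos hp a c).ne']

lemma sum_mul_eq_pCAZ_mul_EYzc [Nonempty A] [Nonempty Y] (hp : IsPMF p) (hind : IndepYA p)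
    (yv : Y → ℝ) (c : C) (a : A) (z : Z) :
    ∑ y, p c a z y * yv y = pCAZ p c a z * EYzc p yv z c := by
  rw [EYzc, mul_sum]
  refine sum_congr rfl fun y _ => ?_
  rw [eq_pCAZ_mul_cYzc hp hind]
  ring

/-- The outcome may be replaced by its regression on (Z, C), and the law of (C, A, Z) by its
factorization, in the expectation of a residual-type function. -/
lemma Ep_residual_add [Nonempty A] [Nonempty Z] [Nonempty Y] (hp : IsPMF p)
    (hzc : IndepZC p) (hind : IndepYA p) (yv : Y → ℝ) (e g : Z → C → ℝ) (d : Z → ℝ)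
    (k : A → Z → C → ℝ) (b : C → ℝ) (t : ℝ) :
    Ep p (fun c a z y => (yv y - e z c) * d z / g z c + k a z c + b c - t)
      = ∑ c, ∑ a, ∑ z, pC p c * cA p a c * cZA p z a *
          ((EYzc p yv z c - e z c) * d z / g z c + k a z c + b c - t) := by
  refine sum_congr rfl fun c _ => sum_congr rfl fun a _ => sum_congr rfl fun z _ => ?_
  rw [← pCAZ_eq_of_indepZC hp hzc]
  calc ∑ y, p c a z y * ((yv y - e z c) * d z / g z c + k a z c + b c - t)
      = (∑ y, p c a z y * yv y) * (d z / g z c)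
        + (∑ y, p c a z y) * (-e z c * (d z / g z c) + k a z c + b c - t) := by
        rw [sum_mul, sum_mul, ← sum_add_distrib]
        exact sum_congr rfl fun y _ => by ring
    _ = _ := by
        rw [sum_mul_eq_pCAZ_mul_EYzc hp hind]
        change _ + pCAZ p c a z * _ = _
        ring

end Factorization

lemma sum_mul_ind_sub [DecidableEq A] (f : A → ℝ) (astar acirc : A) :
    ∑ a, f a * (ind a astar - ind a acirc) = f astar - f acirc := by
  simp [ind, mul_sub, sum_sub_distrib]

/-- Expectation of the three-term function when C ~ r, A | C ~ π and Z | A ~ P. -/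
lemma sum_factorized_eq [DecidableEq A] {r : C → ℝ} {π : A → C → ℝ} {P : Z → A → ℝ}
    (hr : ∑ c, r c = 1) (hπ : ∀ c, ∑ a, π a c = 1) (hP : ∀ a, ∑ z, P z a = 1)
    (u : Z → C → ℝ) (k : A → Z → ℝ) (b : C → ℝ) (t : ℝ) :
    ∑ c, ∑ a, ∑ z, r c * π a c * P z a * (u z c + k a z + b c - t)
      = (∑ c, r c * ∑ z, u z c * ∑ a, π a c * P z a)
        + (∑ a, (∑ c, r c * π a c) * ∑ z, P z a * k a z)
        + (∑ c, r c * b c) - t := by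
  have hu : ∑ c, ∑ a, ∑ z, r c * π a c * P z a * u z c
      = ∑ c, r c * ∑ z, u z c * ∑ a, π a c * P z a := by
    refine sum_congr rfl fun c _ => ?_
    rw [sum_comm, mul_sum]
    refine sum_congr rfl fun z _ => ?_
    rw [mul_sum, mul_sum]
    exact sum_congr rfl fun a _ => by ring
  have hk : ∑ c, ∑ a, ∑ z, r c * π a c * P z a * k a z
      = ∑ a, (∑ c, r c * π a c) * ∑ z, P z a * k a z := by
    rw [sum_comm]
    refine sum_congr rfl fun a _ => ?_
    rw [sum_mul]
    refine sum_congr rfl fun c _ => ?_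
    rw [mul_sum]
    exact sum_congr rfl fun z _ => by ring
  have hconst (f : C → ℝ) : ∑ c, ∑ a, ∑ z, r c * π a c * P z a * f c = ∑ c, r c * f c := by
    simp only [← sum_mul, ← mul_sum, hP, hπ, mul_one]
  have ht := hconst fun _ => t
  rw [← sum_mul, hr, one_mul] at ht
  simp only [mul_add, mul_sub, sum_add_distrib, sum_sub_distrib]
  rw [hu, hk, hconst, ht]

/-- Robustness of the estimating equation based on φ_bdfdtd to misspecified nuisance
models (Theorem 4, consistency part). -/
theorem stmt18
    {C A Z Y : Type*} [Fintype C] [Fintype A] [Fintype Z] [Fintype Y]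
    [Nonempty C] [Nonempty A] [Nonempty Z] [Nonempty Y] [DecidableEq A]
    (p : C → A → Z → Y → ℝ) (yv : Y → ℝ) (hyv : Function.Injective yv)
    (hp : IsPMF p) (astar acirc : A) (hne : astar ≠ acirc)
    (hzc : IndepZC p) (hind : IndepYA p)
    (Eb : Z → C → ℝ)
    (qZ : Z → A → ℝ) (hqZpos : ∀ z a, 0 < qZ z a) (hqZsum : ∀ a, (∑ z, qZ z a) = 1)
    (qA : A → C → ℝ) (hqApos : ∀ a c, 0 < qA a c) (hqAsum : ∀ c, (∑ a, qA a c) = 1)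
    (qC : C → ℝ) (hqCpos : ∀ c, 0 < qC c) (hqCsum : (∑ c, qC c) = 1)
    (hcase :
      ((∀ z c, Eb z c = EYzc p yv z c) ∧ (∀ a c, qA a c = cA p a c) ∧ (∀ c, qC c = pC p c))
      ∨ ((∀ z c, Eb z c = EYzc p yv z c) ∧ (∀ z a, qZ z a = cZA p z a))
      ∨ ((∀ z a, qZ z a = cZA p z a) ∧ (∀ a c, qA a c = cA p a c))) :
    Ep p (fun c a z y =>
      (yv y - Eb z c) * (qZ z astar - qZ z acirc) / (∑ ab, qA ab c * qZ z ab)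
      + (∑ c', (Eb z c' - ∑ z', Eb z' c' * qZ z' a) * qC c')
        * (ind a astar - ind a acirc) / (∑ c', qA a c' * qC c')
      + (∑ z', Eb z' c * (qZ z' astar - qZ z' acirc))
      - thBDFDTD p yv astar acirc) = 0 := by
  have hD : ∀ z c, 0 < ∑ ab, qA ab c * qZ z ab := fun z c =>
    sum_pos (fun a _ => mul_pos (hqApos a c) (hqZpos z a)) univ_nonempty
  have hpC : ∑ c, pC p c = 1 := hp.2
  rw [Ep_residual_add hp hzc hind yv Eb (fun z c => ∑ ab, qA ab c * qZ z ab)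
      (fun z => qZ z astar - qZ z acirc)
      (fun a z _ => (∑ c', (Eb z c' - ∑ z', Eb z' c' * qZ z' a) * qC c')
        * (ind a astar - ind a acirc) / (∑ c', qA a c' * qC c'))
      (fun c => ∑ z', Eb z' c * (qZ z' astar - qZ z' acirc)) (thBDFDTD p yv astar acirc),
    sum_factorized_eq hpC (sum_cA hp) (sum_cZA hp)
      (fun z c => (EYzc p yv z c - Eb z c) * (qZ z astar - qZ z acirc)
        / ∑ ab, qA ab c * qZ z ab)
      (fun a z => (∑ c', (Eb z c' - ∑ z', Eb z' c' * qZ z' a) * qC c')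
        * (ind a astar - ind a acirc) / (∑ c', qA a c' * qC c'))
      (fun c => ∑ z', Eb z' c * (qZ z' astar - qZ z' acirc)), sub_eq_zero, thBDFDTD]
  have hmed : ∀ a, ∑ z, cZA p z a * ((∑ c', (Eb z c' - ∑ z', Eb z' c' * qZ z' a) * qC c')
        * (ind a astar - ind a acirc) / (∑ c', qA a c' * qC c'))
      = (∑ c, qC c * ∑ z, Eb z c * (cZA p z a - qZ z a))
        * (ind a astar - ind a acirc) / (∑ c', qA a c' * qC c') := by
    intro a
    simp only [← mul_div_assoc, ← mul_assoc]
    rw [← sum_div, ← sum_mul]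
    congr 2
    simp only [mul_sum]
    rw [sum_comm]
    refine sum_congr rfl fun c _ => ?_
    calc ∑ z, cZA p z a * ((Eb z c - ∑ z', Eb z' c * qZ z' a) * qC c)
        = qC c * ((∑ z, cZA p z a * Eb z c)
            - (∑ z, cZA p z a) * ∑ z', Eb z' c * qZ z' a) := by
          rw [sum_mul, ← sum_sub_distrib, mul_sum]
          exact sum_congr rfl fun z _ => by ring
      _ = _ := by
          rw [sum_cZA hp, one_mul, ← sum_sub_distrib, mul_sum]
          exact sum_congr rfl fun z _ => by ring
  simp only [hmed]
  rcases hcase with ⟨hE, hA, hC⟩ | ⟨hE, hZ⟩ | ⟨hZ, hA⟩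
  · have hw : ∀ a, ∑ c', qA a c' * qC c' = pA p a := fun a => by
      rw [← sum_pC_mul_cA hp]
      exact sum_congr rfl fun c _ => by rw [hA, hC, mul_comm]
    have hk : ∀ a, pA p a * ((∑ c, qC c * ∑ z, Eb z c * (cZA p z a - qZ z a))
        * (ind a astar - ind a acirc) / pA p a)
        = (∑ c, qC c * ∑ z, Eb z c * (cZA p z a - qZ z a))
          * (ind a astar - ind a acirc) := fun a =>
      mul_div_cancel₀ _ (pA_pos hp a).ne'
    simp only [hw, sum_pC_mul_cA hp, hk]
    rw [sum_mul_ind_sub fun a => ∑ c, qC c * ∑ z, Eb z c * (cZA p z a - qZ z a)]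
    simp only [hE, hC, sub_self, zero_mul, zero_div, sum_const_zero, mul_zero, zero_add]
    rw [← sum_sub_distrib, ← sum_add_distrib]
    refine sum_congr rfl fun c _ => ?_
    rw [← mul_sub, ← mul_add, ← sum_sub_distrib, ← sum_add_distrib, mul_sum]
    exact sum_congr rfl fun z _ => by ring
  · simp only [hE, hZ, sub_self, zero_mul, zero_div, sum_const_zero, mul_zero, zero_add, mul_sum]
    exact sum_congr rfl fun c _ => sum_congr rfl fun z _ => by ring
  · simp only [hZ, hA] at hD
    simp only [hZ, hA, sub_self, zero_mul, zero_div, sum_const_zero, mul_zero, add_zero]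
    rw [← sum_add_distrib]
    refine sum_congr rfl fun c _ => ?_
    rw [← mul_add, ← sum_add_distrib, mul_sum]
    refine sum_congr rfl fun z _ => ?_
    rw [div_mul_cancel₀ _ (hD z c).ne']
    ring

end TwoDoorPaper
end
end

section
/- Let (Ω, μ) be a probability space, let 𝒞, 𝒜, 𝒵, 𝒴 be finite nonempty types, and let C : Ω → 𝒞, A : Ω → 𝒜, Z : Ω → 𝒵, Y : Ω → 𝒴 be measurable maps together with a family of measurable potential outcomes Y_z : Ω → 𝒴 indexed by z ∈ 𝒵. Assume μ({A = a, Z = z, C = c}) > 0 for all (a,z,c). Assume: (consistency) Y(ω) = Y_{Z(ω)}(ω) for μ-almost every ω; (mediator ignorability) for all a ∈ 𝒜, z, z' ∈ 𝒵, c ∈ 𝒞 and y ∈ 𝒴: μ(Y_z = y | A = a, Z = z', C = c) = μ(Y_z = y | A = a, C = c); (treatment ignorability) for all a ∈ 𝒜, z ∈ 𝒵, c ∈ 𝒞 and y ∈ 𝒴: μ(Y_z = y | A = a, C = c) = μ(Y_z = y | C = c). Then the observed outcome distribution given treatment, mediator and covariates does not depend on the treatment: for all a, a' ∈ 𝒜,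 z ∈ 𝒵, c ∈ 𝒞 and y ∈ 𝒴, μ(Y = y | A = a, Z = z, C = c) = μ(Y = y | A = a', Z = z, C = c). -/
open MeasureTheory

/-- Under consistency, mediator ignorability (TD3) and treatment ignorability (back-door),
the observed outcome distribution given (A, Z, C) does not depend on the treatment:
Y ⊥ A | (Z, C). -/
theorem stmt19
    {Ω : Type*} [MeasurableSpace Ω] (μ : Measure Ω) [IsProbabilityMeasure μ]
    {𝒞 𝒜 𝒵 𝒴 : Type*}
    [Fintype 𝒞] [Fintype 𝒜] [Fintype 𝒵] [Fintype 𝒴]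
    [Nonempty 𝒞] [Nonempty 𝒜] [Nonempty 𝒵] [Nonempty 𝒴]
    [MeasurableSpace 𝒞] [MeasurableSingletonClass 𝒞]
    [MeasurableSpace 𝒜] [MeasurableSingletonClass 𝒜]
    [MeasurableSpace 𝒵] [MeasurableSingletonClass 𝒵]
    [MeasurableSpace 𝒴] [MeasurableSingletonClass 𝒴]
    (C : Ω → 𝒞) (A : Ω → 𝒜) (Z : Ω → 𝒵) (Y : Ω → 𝒴) (Yz : 𝒵 → Ω → 𝒴)
    (hC : Measurable C) (hA : Measurable A) (hZ : Measurable Z) (hY : Measurable Y)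
    (hYz : ∀ z, Measurable (Yz z))
    (hpos : ∀ (a : 𝒜) (z : 𝒵) (c : 𝒞), 0 < μ {ω | A ω = a ∧ Z ω = z ∧ C ω = c})
    (hcons : ∀ᵐ ω ∂μ, Y ω = Yz (Z ω) ω)
    (hmed : ∀ (a : 𝒜) (z z' : 𝒵) (c : 𝒞) (y : 𝒴),
      μ ({ω | Yz z ω = y} ∩ {ω | A ω = a ∧ Z ω = z' ∧ C ω = c})
          / μ {ω | A ω = a ∧ Z ω = z' ∧ C ω = c}
        = μ ({ω | Yz z ω = y} ∩ {ω | A ω = a ∧ C ω = c}) / μ {ω | A ω = a ∧ C ω = c})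
    (htrt : ∀ (a : 𝒜) (z : 𝒵) (c : 𝒞) (y : 𝒴),
      μ ({ω | Yz z ω = y} ∩ {ω | A ω = a ∧ C ω = c}) / μ {ω | A ω = a ∧ C ω = c}
        = μ ({ω | Yz z ω = y} ∩ {ω | C ω = c}) / μ {ω | C ω = c}) :
    ∀ (a a' : 𝒜) (z : 𝒵) (c : 𝒞) (y : 𝒴),
      μ ({ω | Y ω = y} ∩ {ω | A ω = a ∧ Z ω = z ∧ C ω = c})
          / μ {ω | A ω = a ∧ Z ω = z ∧ C ω = c}
        = μ ({ω | Y ω = y} ∩ {ω | A ω = a' ∧ Z ω = z ∧ C ω = c})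
          / μ {ω | A ω = a' ∧ Z ω = z ∧ C ω = c} := by
  intro a a' z c y
  have measure_congr_cons (b : 𝒜) :
      μ ({ω | Y ω = y} ∩ {ω | A ω = b ∧ Z ω = z ∧ C ω = c})
        = μ ({ω | Yz z ω = y} ∩ {ω | A ω = b ∧ Z ω = z ∧ C ω = c}) := by
    apply measure_congr
    rw [Filter.eventuallyEq_set]
    filter_upwards [hcons] with ω hω
    simp only [Set.mem_inter_iff, Set.mem_ofPred_eq, and_congr_left_iff]
    rintro ⟨-, rfl, -⟩
    rw [hω]
  rw [measure_congr_cons a, measure_congr_cons a', hmed, hmed, htrt, htrt]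
end
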